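/- Under the Poisson segmentation model, let m be a partition of {1,…,n} into intervals and let u be any distribution that is piecewise Poisson on m, i.e. u(t) = Poisson(μ_J) for all t ∈ J and each segment J ∈ m, with μ_J > 0. Then the Pythagoras-type identity K(s, u) = K(s, s̄_m) + K(s̄_m, u) holds; in particular, s̄_m minimizes K(s, ·) over all distributions that are piecewise Poisson on m. -/

import Mathlib

open MeasureTheory ProbabilityTheory Finset

noncomputable section

namespace Seg

/-- The Poisson probability mass function with parameter `lam`. -/
def poissonPMF (lam : ℝ) (k : ℕ) : ℝ :=
  Real.exp (-lam) * lam ^ k / (Nat.factorial k)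

/-- The negative binomial probability mass function with success probability `p`
and dispersion `phi`. -/
def nbPMF (p phi : ℝ) (k : ℕ) : ℝ :=
  Real.Gamma (phi + k) / (Real.Gamma phi * (Nat.factorial k)) * p ^ phi * (1 - p) ^ k

/-- `segs` is a partition of `{0, …, n-1}` into (nonempty) intervals. -/
def IsIntervalPartition {n : ℕ} (segs : Finset (Finset (Fin n))) : Prop :=
  (∀ J ∈ segs, ∃ a b : Fin n, a ≤ b ∧ J = Finset.Icc a b) ∧
    ∀ t : Fin n, ∃! J, J ∈ segs ∧ t ∈ J

/-- A segmentation (partition into intervals) of `{0, …, n-1}`. -/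
abbrev Segmentation (n : ℕ) := {segs : Finset (Finset (Fin n)) // IsIntervalPartition segs}

/-- `mf` refines `m`: every segment of `mf` is contained in a segment of `m`. -/
def Refines {n : ℕ} (mf m : Segmentation n) : Prop :=
  ∀ I ∈ mf.1, ∃ J ∈ m.1, I ⊆ J

/-- Kullback-Leibler divergence between two product distributions on `ℕ^n`,
given by their coordinate probability mass functions. -/
def KL {n : ℕ} (s u : Fin n → ℕ → ℝ) : ℝ :=
  ∑ t, ∑' k, s t k * Real.log (s t k / u t k)

/-- Squared Hellinger distance between two product distributions on `ℕ^n`. -/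
def hellSq {n : ℕ} (s u : Fin n → ℕ → ℝ) : ℝ :=
  (1 / 2) * ∑ t, ∑' k, (Real.sqrt (s t k) - Real.sqrt (u t k)) ^ 2

/-- Empirical mean of the data `y` over the segment `J`. -/
def Ybar {n : ℕ} (y : Fin n → ℕ) (J : Finset (Fin n)) : ℝ :=
  (∑ t ∈ J, (y t : ℝ)) / J.card

/-- The product distribution which, on each segment `J` of `m`, has coordinate pmf `f J`. -/
def pw {n : ℕ} (m : Segmentation n) (f : Finset (Fin n) → ℕ → ℝ) : Fin n → ℕ → ℝ :=
  fun t k => ∑ J ∈ m.1, if t ∈ J then f J k else 0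

/-- Poisson maximum-likelihood estimator on the partition `m` given data `y`:
`Poisson(Ȳ_J)` on each segment `J`. -/
def shatP {n : ℕ} (m : Segmentation n) (y : Fin n → ℕ) : Fin n → ℕ → ℝ :=
  pw m fun J => poissonPMF (Ybar y J)

/-- Kullback-Leibler projection in the Poisson model: `Poisson(λ̄_J)` on each segment. -/
def sbarP {n : ℕ} (lam : Fin n → ℝ) (m : Segmentation n) : Fin n → ℕ → ℝ :=
  pw m fun J => poissonPMF ((∑ t ∈ J, lam t) / J.card)

/-- Negative binomial maximum-likelihood estimator on the partition `m` given data `y`: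
`NB(φ/(φ+Ȳ_J), φ)` on each segment `J`. -/
def shatNB {n : ℕ} (phi : ℝ) (m : Segmentation n) (y : Fin n → ℕ) : Fin n → ℕ → ℝ :=
  pw m fun J => nbPMF (phi / (phi + Ybar y J)) phi

/-- Kullback-Leibler projection in the negative binomial model: `NB(p_J, φ)` on each
segment, with `p_J = |J| / ∑_{t∈J} 1/p_t`. -/
def sbarNB {n : ℕ} (p : Fin n → ℝ) (phi : ℝ) (m : Segmentation n) : Fin n → ℕ → ℝ :=
  pw m fun J => nbPMF ((J.card : ℝ) / ∑ t ∈ J, 1 / p t) phi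

/-- Log-likelihood contrast `γ(u) = -∑_t log P_u(y_t)`. -/
def contrast {n : ℕ} (u : Fin n → ℕ → ℝ) (y : Fin n → ℕ) : ℝ :=
  ∑ t, -Real.log (u t (y t))

/-- Centered contrast `γ̄(u) = γ(u) - E[γ(u)]` evaluated at the data `ω`. -/
def cbar {n : ℕ} {Ω : Type*} [MeasurableSpace Ω] (μ : Measure Ω) (Y : Fin n → Ω → ℕ)
    (u : Fin n → ℕ → ℝ) (ω : Ω) : ℝ :=
  contrast u (fun t => Y t ω) - ∫ ω', contrast u (fun t => Y t ω') ∂μ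

/-- The chi-square statistic `χ²_m = ∑_{J∈m} |J| (Ȳ_J - Ē_J)² / Ē_J`. -/
def chi2 {n : ℕ} (E : Fin n → ℝ) (m : Segmentation n) (y : Fin n → ℕ) : ℝ :=
  ∑ J ∈ m.1, (J.card : ℝ) * (Ybar y J - (∑ t ∈ J, E t) / J.card) ^ 2
    / ((∑ t ∈ J, E t) / J.card)

/-- The event `Ω_{m_f}(ε) = ∩_{J ∈ m_f} {|Y_J/E_J - 1| ≤ ε}`. -/
def goodEvent {n : ℕ} {Ω : Type*} (Y : Fin n → Ω → ℕ) (E : Fin n → ℝ)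
    (mf : Segmentation n) (ε : ℝ) : Set Ω :=
  {ω | ∀ J ∈ mf.1, |(∑ t ∈ J, (Y t ω : ℝ)) / (∑ t ∈ J, E t) - 1| ≤ ε}

end Seg

lemma hasSum_of_eq {f g : ℕ → ℝ} {c : ℝ} (h : HasSum f c) (e : g = f) : HasSum g c := by
  rw [e]
  exact h

open Seg in
lemma poisson_hasSum (a : ℝ) : HasSum (poissonPMF a) 1 := by
  have h := (NormedSpace.expSeries_div_hasSum_exp (𝔸 := ℝ) a).mul_left (Real.exp (-a))
  rw [← Real.exp_eq_exp_ℝ, ← Real.exp_add] at h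
  simp only [neg_add_cancel, Real.exp_zero] at h
  refine hasSum_of_eq h ?_
  funext k
  simp only [Seg.poissonPMF]
  ring

open Seg in
lemma poisson_hasSum_mean (a : ℝ) : HasSum (fun k : ℕ => poissonPMF a k * k) a := by
  rw [← hasSum_nat_add_iff' 1]
  have h := (poisson_hasSum a).mul_left a
  simp only [Finset.range_one, Finset.sum_singleton, Nat.cast_zero, mul_zero, sub_zero]
  rw [mul_one] at h
  refine hasSum_of_eq h ?_
  funext k
  simp only [Seg.poissonPMF, Nat.factorial_succ]
  push_cast
  field_simp
  try ring

open Seg in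
lemma poisson_kl (a b : ℝ) (ha : 0 < a) (hb : 0 < b) :
    ∑' k, poissonPMF a k * Real.log (poissonPMF a k / poissonPMF b k) =
      b - a + a * (Real.log a - Real.log b) := by
  have h := ((poisson_hasSum a).mul_left (b - a)).add
    ((poisson_hasSum_mean a).mul_left (Real.log a - Real.log b))
  have e : (b - a) * 1 + (Real.log a - Real.log b) * a
      = b - a + a * (Real.log a - Real.log b) := by ring
  rw [e] at h
  rw [← h.tsum_eq]
  refine tsum_congr fun k => ?_
  have hl : Real.log (poissonPMF a k / poissonPMF b k) =
      (b - a) + (Real.log a - Real.log b) * k := by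
    have hf : (Nat.factorial k : ℝ) ≠ 0 := by positivity
    have h1 : ∀ c : ℝ, 0 < c → Real.log (poissonPMF c k) =
        -c + k * Real.log c - Real.log (Nat.factorial k) := by
      intro c hc
      unfold Seg.poissonPMF
      rw [Real.log_div (by positivity) hf, Real.log_mul (by positivity) (by positivity),
        Real.log_exp, Real.log_pow]
    have h2 : ∀ c : ℝ, 0 < c → poissonPMF c k ≠ 0 := by
      intro c hc
      unfold Seg.poissonPMF
      positivity
    rw [Real.log_div (h2 a ha) (h2 b hb), h1 a ha, h1 b hb]
    ring
  rw [hl]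
  ring

lemma poisson_kl_nonneg (a b : ℝ) (ha : 0 < a) (hb : 0 < b) :
    0 ≤ b - a + a * (Real.log a - Real.log b) := by
  have h := Real.log_le_sub_one_of_pos (div_pos hb ha)
  rw [Real.log_div hb.ne' ha.ne'] at h
  have h2 := mul_le_mul_of_nonneg_left h ha.le
  have h3 : a * (b / a - 1) = b - a := by field_simp
  rw [h3] at h2
  linarith

open Seg in
/-- **Pythagoras-type identity for the Poisson model.** If `u` is piecewise Poisson on the
partition `m` (equal to `Poisson(μ_J)` on each segment `J ∈ m`, `μ_J > 0`), then
`K(s, u) = K(s, s̄_m) + K(s̄_m, u)`; in particular `s̄_m` minimizes `K(s, ·)` over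
distributions that are piecewise Poisson on `m`. -/
theorem statement11 (n : ℕ) (lam : Fin n → ℝ) (hlam : ∀ t, 0 < lam t)
    (m : Segmentation n) (muJ : Finset (Fin n) → ℝ) (hmu : ∀ J ∈ m.1, 0 < muJ J) :
    KL (fun t => poissonPMF (lam t)) (pw m fun J => poissonPMF (muJ J)) =
        KL (fun t => poissonPMF (lam t)) (sbarP lam m) +
          KL (sbarP lam m) (pw m fun J => poissonPMF (muJ J)) ∧
      KL (fun t => poissonPMF (lam t)) (sbarP lam m) ≤
        KL (fun t => poissonPMF (lam t)) (pw m fun J => poissonPMF (muJ J)) := by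
  obtain ⟨m, hm⟩ := m
  choose seg hseg huniq using hm.2
  simp only at hseg huniq hmu
  have hpw : ∀ f : Finset (Fin n) → ℕ → ℝ, pw ⟨m, hm⟩ f = fun t => f (seg t) := by
    intro f
    funext t k
    simp only [pw]
    rw [Finset.sum_eq_single (seg t)]
    · rw [if_pos (hseg t).2]
    · intro J hJ hne
      rw [if_neg]
      intro ht
      exact hne (huniq t J ⟨hJ, ht⟩)
    · intro h
      exact absurd (hseg t).1 h
  have hfil : ∀ J ∈ m, Finset.univ.filter (fun t => seg t = J) = J := by
    intro J hJ
    ext t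
    simp only [Finset.mem_filter, Finset.mem_univ, true_and]
    constructor
    · rintro rfl
      exact (hseg t).2
    · intro ht
      exact (huniq t J ⟨hJ, ht⟩).symm
  set L : Finset (Fin n) → ℝ := fun J => (∑ t ∈ J, lam t) / J.card with hL
  have hLpos : ∀ t, 0 < L (seg t) := by
    intro t
    have hne : (seg t).Nonempty := ⟨t, (hseg t).2⟩
    exact div_pos (Finset.sum_pos (fun i _ => hlam i) hne)
      (by exact_mod_cast hne.card_pos)
  have hmupos : ∀ t, 0 < muJ (seg t) := fun t => hmu _ (hseg t).1
  have hzero : ∀ c : Finset (Fin n) → ℝ, ∑ t, (lam t - L (seg t)) * c (seg t) = 0 := by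
    intro c
    rw [← Finset.sum_fiberwise_of_maps_to (s := Finset.univ) (t := m) (g := seg)
      (fun t _ => (hseg t).1)]
    refine Finset.sum_eq_zero fun J hJ => ?_
    have h1 : ∀ t ∈ Finset.univ.filter (fun t => seg t = J),
        (lam t - L (seg t)) * c (seg t) = (lam t - L J) * c J := by
      intro t ht
      rw [(Finset.mem_filter.1 ht).2]
    rw [Finset.sum_congr rfl h1, hfil J hJ, ← Finset.sum_mul, Finset.sum_sub_distrib,
      Finset.sum_const, nsmul_eq_mul]
    obtain ⟨a, b, hab, hJab⟩ := hm.1 J hJ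
    have hne : J.Nonempty := by
      rw [hJab]
      exact Finset.nonempty_Icc.2 hab
    have hc : (J.card : ℝ) ≠ 0 := by exact_mod_cast hne.card_pos.ne'
    have h2 : (J.card : ℝ) * L J = ∑ t ∈ J, lam t := by
      simp only [hL]
      field_simp
    rw [h2, sub_self, zero_mul]
  have hmain : KL (fun t => poissonPMF (lam t)) (pw ⟨m, hm⟩ fun J => poissonPMF (muJ J)) =
        KL (fun t => poissonPMF (lam t)) (sbarP lam ⟨m, hm⟩) +
          KL (sbarP lam ⟨m, hm⟩) (pw ⟨m, hm⟩ fun J => poissonPMF (muJ J)) := by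
    have h3 := hzero (fun J => Real.log (L J) - Real.log (muJ J) - 1)
    have h4 := hzero (fun _ => 1)
    simp only [sbarP, hpw, KL]
    change ∑ t, _ = ∑ t, ∑' k, poissonPMF (lam t) k *
        Real.log (poissonPMF (lam t) k / poissonPMF (L (seg t)) k) +
      ∑ t, ∑' k, poissonPMF (L (seg t)) k *
        Real.log (poissonPMF (L (seg t)) k / poissonPMF (muJ (seg t)) k)
    simp only [poisson_kl _ _ (hlam _) (hmupos _), poisson_kl _ _ (hlam _) (hLpos _),
      poisson_kl _ _ (hLpos _) (hmupos _)]
    rw [← Finset.sum_add_distrib, ← sub_eq_zero, ← Finset.sum_sub_distrib,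
      ← add_zero (0 : ℝ)]
    nth_rewrite 1 [← h3]
    rw [← h4, ← Finset.sum_add_distrib]
    refine Finset.sum_congr rfl fun t _ => ?_
    ring
  refine ⟨hmain, ?_⟩
  rw [hmain]
  refine le_add_of_nonneg_right ?_
  simp only [sbarP, hpw, KL]
  refine Finset.sum_nonneg fun t _ => ?_
  rw [poisson_kl _ _ (hLpos t) (hmupos t)]
  exact poisson_kl_nonneg _ _ (hLpos t) (hmupos t)
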